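/- For every ε > 0 there exists Q₀ such that the following holds for every prime q ≥ Q₀. Let a be an integer coprime to q, let κ ∈ {-1, +1}, and let N ≥ q^{2+ε}. Suppose λ(n) = κ for every positive integer n ≤ N with n ≡ a (mod q). Then for every interval I = [M, M + q) of length q contained in [1, N/q], one has #{n ∈ I : gcd(n, q) = 1, λ(n) = -1} = φ(q)/2 and #{n ∈ I : gcd(n, q) = 1, λ(n) = +1} = φ(q)/2. -/

import Mathlib

open scoped BigOperators

/-- The Liouville function `λ(n) = (-1)^Ω(n)`. -/
def liouville (n : ℕ) : ℤ := (-1) ^ (ArithmeticFunction.cardFactors n)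

theorem liouville_mul {m n : ℕ} (hm : m ≠ 0) (hn : n ≠ 0) :
    liouville (m * n) = liouville m * liouville n := by
  simp [liouville, ArithmeticFunction.cardFactors_mul hm hn, pow_add]

theorem liouville_two : liouville 2 = -1 := by
  simp [liouville, ArithmeticFunction.cardFactors_apply_prime Nat.prime_two]

theorem liouville_ne_zero (n : ℕ) : liouville n ≠ 0 := by
  simp [liouville]

theorem liouville_eq_or (n : ℕ) : liouville n = -1 ∨ liouville n = 1 :=
  (neg_one_pow_eq_or ℤ _).symm

/-- If `λ` is constant on the part of the residue class `a` mod `q` below `N`, then, up to `N / q`,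
the value `λ m` depends only on the class of `m` mod `q`. -/
theorem liouville_eq_liouville_val {q : ℕ} [Fact q.Prime] {a : ZMod q} (ha : a ≠ 0) {κ : ℤ} {N : ℝ}
    (hN : (q : ℝ) * q ≤ N)
    (h : ∀ n : ℕ, 0 < n → (n : ℝ) ≤ N → (n : ZMod q) = a → liouville n = κ)
    {m : ℕ} (hm : (m : ZMod q) ≠ 0) (hmN : (m : ℝ) * q ≤ N) :
    liouville m = liouville (m : ZMod q).val := by
  set n : ℕ := (a * (m : ZMod q)⁻¹).val with hn
  have hn0 : n ≠ 0 := by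
    rw [hn, Ne, ZMod.val_eq_zero]
    exact mul_ne_zero ha (inv_ne_zero hm)
  have hnq : (n : ℝ) ≤ q := by exact_mod_cast (ZMod.val_lt _).le
  have hv0 : (m : ZMod q).val ≠ 0 := by rwa [Ne, ZMod.val_eq_zero]
  have hvq : ((m : ZMod q).val : ℝ) ≤ q := by exact_mod_cast (ZMod.val_lt _).le
  have key : ∀ k : ℕ, k ≠ 0 → (k : ZMod q) = m → (k : ℝ) * q ≤ N →
      liouville k * liouville n = κ := by
    intro k hk hkm hkN
    rw [← liouville_mul hk hn0]
    refine h _ (by positivity) ?_ ?_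
    · push_cast
      exact (mul_le_mul_of_nonneg_left hnq (by positivity)).trans hkN
    · rw [Nat.cast_mul, hkm, hn, ZMod.natCast_zmod_val]
      field_simp
  have hm0 : m ≠ 0 := by
    rintro rfl
    simp at hm
  have h₁ := key m hm0 rfl hmN
  have h₂ := key _ hv0 (ZMod.natCast_zmod_val _)
    ((mul_le_mul_of_nonneg_right hvq (by positivity)).trans hN)
  exact mul_right_cancel₀ (liouville_ne_zero n) (h₁.trans h₂.symm)

/-- An interval of length `q` contains exactly one representative of every class mod `q`. -/
theorem card_filter_Ico_natCast {q : ℕ} [NeZero q] (M : ℕ) (P : ZMod q → Prop) [DecidablePred P] :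
    ((Finset.Ico M (M + q)).filter (fun n : ℕ => P (n : ZMod q))).card
      = (Finset.univ.filter P).card := by
  refine Finset.card_bij (fun n _ => (n : ZMod q)) ?_ ?_ ?_
  · intro n hn
    simpa using (Finset.mem_filter.1 hn).2
  · intro m hm n hn hmn
    simp only [Finset.mem_filter, Finset.mem_Ico] at hm hn
    rw [ZMod.natCast_eq_natCast_iff] at hmn
    exact Nat.ModEq.eq_of_abs_lt hmn (by rw [abs_lt]; omega)
  · intro x hx
    have hc : ((M + (x - (M : ZMod q)).val : ℕ) : ZMod q) = x := by
      rw [Nat.cast_add, ZMod.natCast_zmod_val]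
      ring
    refine ⟨M + (x - (M : ZMod q)).val, ?_, hc⟩
    have hlt := ZMod.val_lt (x - (M : ZMod q))
    rw [Finset.mem_filter, Finset.mem_Ico, hc]
    exact ⟨by omega, by simpa using hx⟩

/-- A function with values `± 1` on the nonzero elements of a finite field that is negated by
doubling takes both values equally often. -/
theorem two_mul_card_filter_of_map_two_mul {F : Type*} [Field F] [Fintype F] [DecidableEq F]
    (h2 : (2 : F) ≠ 0)
    {f : F → ℤ} (hf : ∀ x, f x = -1 ∨ f x = 1) (hneg : ∀ x, x ≠ 0 → f (2 * x) = -f x) :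
    2 * (Finset.univ.filter (fun x => x ≠ 0 ∧ f x = -1)).card = Fintype.card F - 1 ∧
    2 * (Finset.univ.filter (fun x => x ≠ 0 ∧ f x = 1)).card = Fintype.card F - 1 := by
  have heq : (Finset.univ.filter (fun x => x ≠ 0 ∧ f x = -1)).card
      = (Finset.univ.filter (fun x => x ≠ 0 ∧ f x = 1)).card := by
    apply le_antisymm <;>
    · refine Finset.card_le_card_of_injOn (fun x => 2 * x) ?_
        (fun x _ y _ hxy => mul_left_cancel₀ h2 hxy)
      intro x hx
      simp only [Finset.coe_filter, Finset.mem_univ, true_and, Set.mem_ofPred_eq] at hx ⊢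
      exact ⟨mul_ne_zero h2 hx.1, by simp [hneg x hx.1, hx.2]⟩
  have hsum : (Finset.univ.filter (fun x => x ≠ 0 ∧ f x = -1)).card
      + (Finset.univ.filter (fun x => x ≠ 0 ∧ f x = 1)).card = Fintype.card F - 1 := by
    rw [← Finset.card_union_of_disjoint, ← Finset.filter_or, ← Finset.card_univ,
      ← Finset.card_erase_of_mem (Finset.mem_univ (0 : F))]
    · congr 1
      ext x
      have := hf x
      simp only [Finset.mem_filter, Finset.mem_univ, true_and, Finset.mem_erase, and_true]
      tauto
    · rw [Finset.disjoint_filter]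
      rintro x - ⟨-, hx⟩ ⟨-, hx'⟩
      omega
  omega

open Classical in
theorem constant_sign_implies_equidistribution_in_all_intervals
    (ε : ℝ) (hε : 0 < ε) :
    ∃ Q₀ : ℕ, ∀ q : ℕ, q.Prime → Q₀ ≤ q →
      ∀ a : ℤ, Int.gcd a q = 1 →
        ∀ κ : ℤ, (κ = -1 ∨ κ = 1) →
          ∀ N : ℝ, (q : ℝ) ^ ((2 : ℝ) + ε) ≤ N →
            (∀ n : ℕ, 0 < n → (n : ℝ) ≤ N → (n : ℤ) ≡ a [ZMOD (q : ℤ)] →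
              liouville n = κ) →
            ∀ M : ℕ, 1 ≤ M → (M + q - 1 : ℝ) ≤ N / q →
              2 * ((Finset.Ico M (M + q)).filter
                  (fun n => n.Coprime q ∧ liouville n = -1)).card = Nat.totient q ∧
              2 * ((Finset.Ico M (M + q)).filter
                  (fun n => n.Coprime q ∧ liouville n = 1)).card = Nat.totient q := by
  refine ⟨max 3 ⌈(2 : ℝ) ^ (1 / ε)⌉₊, fun q hq hQ a ha κ _ N hN h M hM hMN => ?_⟩
  have : Fact q.Prime := ⟨hq⟩
  have hq3 : 3 ≤ q := (le_max_left _ _).trans hQ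
  have hq0 : (0 : ℝ) < q := by exact_mod_cast hq.pos
  have hqε : (2 : ℝ) ≤ (q : ℝ) ^ ε := by
    have h₁ : (2 : ℝ) ^ (1 / ε) ≤ q :=
      (Nat.le_ceil _).trans (by exact_mod_cast (le_max_right _ _).trans hQ)
    calc (2 : ℝ) = ((2 : ℝ) ^ (1 / ε)) ^ ε := by
          rw [← Real.rpow_mul (by norm_num), one_div_mul_cancel hε.ne', Real.rpow_one]
      _ ≤ (q : ℝ) ^ ε := Real.rpow_le_rpow (by positivity) h₁ hε.le
  have hN2 : 2 * (q : ℝ) * q ≤ N := by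
    refine le_trans ?_ hN
    rw [Real.rpow_add hq0, Real.rpow_two]
    nlinarith [mul_pos hq0 hq0]
  have ha0 : (a : ZMod q) ≠ 0 := by
    rw [Ne, ZMod.intCast_zmod_eq_zero_iff_dvd]
    intro hd
    have hd' := Int.dvd_coe_gcd hd (dvd_refl (q : ℤ))
    rw [ha] at hd'
    exact hq.one_lt.ne' (Nat.dvd_one.1 (by exact_mod_cast hd'))
  have hperiod : ∀ {m : ℕ}, (m : ZMod q) ≠ 0 → (m : ℝ) * q ≤ N →
      liouville m = liouville (m : ZMod q).val := by
    refine liouville_eq_liouville_val ha0 (κ := κ) (by nlinarith) (fun n hn hnN hna => ?_)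
    refine h n hn hnN ?_
    rw [← ZMod.intCast_eq_intCast_iff]
    exact_mod_cast hna
  have h2 : (2 : ZMod q) ≠ 0 := by
    have : ((2 : ℕ) : ZMod q) ≠ 0 := by
      rw [Ne, ZMod.natCast_eq_zero_iff]
      exact Nat.not_dvd_of_pos_of_lt (by norm_num) hq3
    exact_mod_cast this
  have hneg : ∀ x : ZMod q, x ≠ 0 → liouville (2 * x).val = -liouville x.val := by
    intro x hx
    have hc : ((2 * x.val : ℕ) : ZMod q) = 2 * x := by
      rw [Nat.cast_mul, ZMod.natCast_zmod_val, Nat.cast_ofNat]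
    have hxq : (x.val : ℝ) ≤ q := by exact_mod_cast (ZMod.val_lt x).le
    have hp := hperiod (m := 2 * x.val) (by rw [hc]; exact mul_ne_zero h2 hx)
      (by push_cast; nlinarith)
    rw [hc, liouville_mul two_ne_zero (by rwa [Ne, ZMod.val_eq_zero]), liouville_two] at hp
    omega
  have hcount : ∀ s : ℤ, ((Finset.Ico M (M + q)).filter
      (fun n => n.Coprime q ∧ liouville n = s)).card
      = (Finset.univ.filter (fun x : ZMod q => x ≠ 0 ∧ liouville x.val = s)).card := by
    intro s
    rw [← card_filter_Ico_natCast M (fun x : ZMod q => x ≠ 0 ∧ liouville x.val = s)]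
    congr 1
    refine Finset.filter_congr fun n hn => ?_
    have hcop : n.Coprime q ↔ (n : ZMod q) ≠ 0 := by
      rw [Ne, ZMod.natCast_eq_zero_iff, Nat.coprime_comm, hq.coprime_iff_not_dvd]
    rw [hcop]
    refine and_congr_right fun hn0 => ?_
    have hnM : (n : ℝ) + 1 ≤ M + q := by exact_mod_cast (Finset.mem_Ico.1 hn).2
    rw [hperiod hn0 ((le_div_iff₀ hq0).1 (by linarith))]
  rw [hcount, hcount, Nat.totient_prime hq]
  simpa only [ZMod.card] using
    two_mul_card_filter_of_map_two_mul h2 (fun x => liouville_eq_or x.val) hneg
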